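/- Let C be a prevariety of languages over a finite alphabet A. Then the unambiguous polynomial closure, the alternated polynomial closure, and the weak alternated polynomial closure of C coincide: UPol(C) = APol(C) = WAPol(C). -/

import Mathlib

/- Common definitions: languages over a finite alphabet, classes of languages,
prevarieties, polynomial closure and its variants, separation, C-pairs, etc. -/

namespace RegLang

variable {A : Type}

/-- A language over the alphabet `A`: a set of finite words. -/
abbrev Lang (A : Type) := Set (FreeMonoid A)

/-- A class of languages over the alphabet `A`. -/
abbrev LangClass (A : Type) := Set (Lang A)

/-- A lattice of languages: contains `∅` and `A*` and is closed under binary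
union and intersection. -/
def IsLatticeClass (C : LangClass A) : Prop :=
  ∅ ∈ C ∧ (Set.univ : Lang A) ∈ C ∧
    (∀ K L : Lang A, K ∈ C → L ∈ C → K ∪ L ∈ C) ∧
    (∀ K L : Lang A, K ∈ C → L ∈ C → K ∩ L ∈ C)

/-- A Boolean algebra of languages: a lattice of languages closed under complement. -/
def IsBooleanAlgebraClass (C : LangClass A) : Prop :=
  IsLatticeClass C ∧ ∀ L ∈ C, Lᶜ ∈ C

/-- A class is quotient-closed if it is closed under left and right quotients by words. -/
def QuotientClosed (C : LangClass A) : Prop :=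
  ∀ L ∈ C, ∀ u : FreeMonoid A,
    {w : FreeMonoid A | u * w ∈ L} ∈ C ∧ {w : FreeMonoid A | w * u ∈ L} ∈ C

/-- A language is regular if it is a preimage of a subset under a monoid morphism
into a finite monoid. -/
def IsRegularLang (L : Lang A) : Prop :=
  ∃ (M : Type) (_ : Monoid M) (_ : Finite M) (φ : FreeMonoid A →* M) (F : Set M),
    L = φ ⁻¹' F

/-- A positive prevariety: a quotient-closed lattice of regular languages. -/
def IsPositivePrevariety (C : LangClass A) : Prop :=
  IsLatticeClass C ∧ QuotientClosed C ∧ ∀ L ∈ C, IsRegularLang L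

/-- A prevariety: a quotient-closed Boolean algebra of regular languages. -/
def IsPrevariety (C : LangClass A) : Prop :=
  IsBooleanAlgebraClass C ∧ QuotientClosed C ∧ ∀ L ∈ C, IsRegularLang L

/-- The marked concatenation `KaL = {uav : u ∈ K, v ∈ L}`. -/
def MarkedCat (K : Lang A) (a : A) (L : Lang A) : Lang A :=
  {w | ∃ u ∈ K, ∃ v ∈ L, w = u * FreeMonoid.of a * v}

/-- A marked concatenation `KaL` is unambiguous if every word of `KaL` has a
unique factorization `uav` with `u ∈ K` and `v ∈ L`. -/
def Unambiguous (K : Lang A) (a : A) (L : Lang A) : Prop :=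
  ∀ u u' v v' : FreeMonoid A, u ∈ K → u' ∈ K → v ∈ L → v' ∈ L →
    u * FreeMonoid.of a * v = u' * FreeMonoid.of a * v' → u = u' ∧ v = v'

/-- The marked concatenation `KaL` is left deterministic: `K ∩ KaA* = ∅`. -/
def LeftDeterministic (K : Lang A) (a : A) (_L : Lang A) : Prop :=
  K ∩ MarkedCat K a Set.univ = ∅

/-- The marked concatenation `KaL` is right deterministic: `L ∩ A*aL = ∅`. -/
def RightDeterministic (_K : Lang A) (a : A) (L : Lang A) : Prop :=
  L ∩ MarkedCat Set.univ a L = ∅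

/-- Polynomial closure: the least class containing `C` and closed under binary
union and marked concatenation. -/
inductive Pol (C : LangClass A) : Lang A → Prop
  | base {L : Lang A} : L ∈ C → Pol C L
  | union {K L : Lang A} : Pol C K → Pol C L → Pol C (K ∪ L)
  | mcat {K L : Lang A} (a : A) : Pol C K → Pol C L → Pol C (MarkedCat K a L)

/-- `coPol C`: the class of complements of languages in `Pol C`. -/
def coPol (C : LangClass A) : LangClass A := {L | ∃ K : Lang A, Pol C K ∧ L = Kᶜ}

/-- `BPol C`: the least Boolean algebra of languages containing `Pol C`. -/
inductive BPol (C : LangClass A) : Lang A → Prop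
  | base {L : Lang A} : Pol C L → BPol C L
  | empty : BPol C ∅
  | univ : BPol C Set.univ
  | union {K L : Lang A} : BPol C K → BPol C L → BPol C (K ∪ L)
  | inter {K L : Lang A} : BPol C K → BPol C L → BPol C (K ∩ L)
  | compl {L : Lang A} : BPol C L → BPol C Lᶜ

/-- Unambiguous polynomial closure: the least class containing `C` and closed
under disjoint union and unambiguous marked concatenation. -/
inductive UPol (C : LangClass A) : Lang A → Prop
  | base {L : Lang A} : L ∈ C → UPol C L
  | disjUnion {K L : Lang A} : UPol C K → UPol C L → K ∩ L = ∅ → UPol C (K ∪ L)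
  | mcat {K L : Lang A} (a : A) : UPol C K → UPol C L → Unambiguous K a L →
      UPol C (MarkedCat K a L)

/-- Alternated polynomial closure: the least class containing `C` and closed under
disjoint union and left- and right-deterministic marked concatenation. -/
inductive APol (C : LangClass A) : Lang A → Prop
  | base {L : Lang A} : L ∈ C → APol C L
  | disjUnion {K L : Lang A} : APol C K → APol C L → K ∩ L = ∅ → APol C (K ∪ L)
  | leftCat {K L : Lang A} (a : A) : APol C K → APol C L → LeftDeterministic K a L →
      APol C (MarkedCat K a L)
  | rightCat {K L : Lang A} (a : A) : APol C K → APol C L → RightDeterministic K a L →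
      APol C (MarkedCat K a L)

/-- `KaL` is left `C`-deterministic: there are `K', L' ∈ C` with `K ⊆ K'`, `L ⊆ L'`
and `K'aL'` left deterministic. -/
def LeftCDeterministic (C : LangClass A) (K : Lang A) (a : A) (L : Lang A) : Prop :=
  ∃ K' ∈ C, ∃ L' ∈ C, K ⊆ K' ∧ L ⊆ L' ∧ LeftDeterministic K' a L'

/-- `KaL` is right `C`-deterministic: there are `K', L' ∈ C` with `K ⊆ K'`, `L ⊆ L'`
and `K'aL'` right deterministic. -/
def RightCDeterministic (C : LangClass A) (K : Lang A) (a : A) (L : Lang A) : Prop :=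
  ∃ K' ∈ C, ∃ L' ∈ C, K ⊆ K' ∧ L ⊆ L' ∧ RightDeterministic K' a L'

/-- Weak alternated polynomial closure: the least class containing `C` and closed under
disjoint union and left- and right-`C`-deterministic marked concatenation. -/
inductive WAPol (C : LangClass A) : Lang A → Prop
  | base {L : Lang A} : L ∈ C → WAPol C L
  | disjUnion {K L : Lang A} : WAPol C K → WAPol C L → K ∩ L = ∅ → WAPol C (K ∪ L)
  | leftCat {K L : Lang A} (a : A) : WAPol C K → WAPol C L →
      LeftCDeterministic C K a L → WAPol C (MarkedCat K a L)
  | rightCat {K L : Lang A} (a : A) : WAPol C K → WAPol C L →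
      RightCDeterministic C K a L → WAPol C (MarkedCat K a L)

/-- `K` separates `L₁` from `L₂`. -/
def Separates (K L₁ L₂ : Lang A) : Prop := L₁ ⊆ K ∧ K ∩ L₂ = ∅

/-- `L₁` is `C`-separable from `L₂`. -/
def Separable (C : LangClass A) (L₁ L₂ : Lang A) : Prop := ∃ K ∈ C, Separates K L₁ L₂

/-- `(s, t)` is a `C`-pair for `φ`: `φ⁻¹(s)` is not `C`-separable from `φ⁻¹(t)`. -/
def CPair (C : LangClass A) {M : Type} [Monoid M] (φ : FreeMonoid A →* M)
    (s t : M) : Prop :=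
  ¬ Separable C (φ ⁻¹' {s}) (φ ⁻¹' {t})

/-- The canonical `C`-preorder on `M` associated with `φ`. -/
def CPreorder (C : LangClass A) {M : Type} [Monoid M] (φ : FreeMonoid A →* M)
    (s t : M) : Prop :=
  ∀ F : Set M, φ ⁻¹' F ∈ C → s ∈ F → t ∈ F

/-- The canonical `C`-equivalence on `M` associated with `φ`. -/
def CEquiv (C : LangClass A) {M : Type} [Monoid M] (φ : FreeMonoid A →* M)
    (s t : M) : Prop :=
  ∀ F : Set M, φ ⁻¹' F ∈ C → (s ∈ F ↔ t ∈ F)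

/-- A `C`-morphism: a surjective morphism all of whose recognized languages are in `C`. -/
def IsCMorphism (C : LangClass A) {N : Type} [Monoid N] (η : FreeMonoid A →* N) : Prop :=
  Function.Surjective η ∧ ∀ F : Set N, η ⁻¹' F ∈ C

/-- `e` is the idempotent power `s^ω` of `s`: an idempotent of the form `s^n`, `n ≥ 1`
(in a finite monoid such an element exists and is unique). -/
def IsIdempotentPower {M : Type} [Monoid M] (s e : M) : Prop :=
  IsIdempotentElem e ∧ ∃ n : ℕ, 1 ≤ n ∧ e = s ^ n

/-- The `C`-kernel of `φ`: the elements `s` such that `{ε}` is not `C`-separable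
from `φ⁻¹(s)`. -/
def gKernel (C : LangClass A) {M : Type} [Monoid M] (φ : FreeMonoid A →* M) : Set M :=
  {s | ¬ Separable C ({1} : Lang A) (φ ⁻¹' {s})}

/-- The strict `C`-kernel of `φ`: the intersection of the `C`-kernel with `φ(A⁺)`. -/
def strictGKernel (C : LangClass A) {M : Type} [Monoid M]
    (φ : FreeMonoid A →* M) : Set M :=
  gKernel C φ ∩ φ '' {w : FreeMonoid A | w ≠ 1}

/-- A group language: one recognized by a morphism into a finite group. -/
def IsGroupLanguage (L : Lang A) : Prop :=
  ∃ (G : Type) (_ : Group G) (_ : Finite G) (φ : FreeMonoid A →* G) (F : Set G),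
    L = φ ⁻¹' F

/-- A prevariety of group languages. -/
def IsGroupPrevariety (G : LangClass A) : Prop :=
  IsPrevariety G ∧ ∀ L ∈ G, IsGroupLanguage L

/-- The well-suited extension `G⁺`: all languages `L ∩ A⁺` and `L ∪ {ε}` for `L ∈ G`. -/
def wellSuited (G : LangClass A) : LangClass A :=
  {L | ∃ K ∈ G, L = K ∩ {w : FreeMonoid A | w ≠ 1} ∨ L = K ∪ ({1} : Lang A)}

/-- `le` is a partial order on the monoid `N` compatible with multiplication. -/
def IsCompatiblePartialOrder {N : Type} [Monoid N] (le : N → N → Prop) : Prop :=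
  (∀ x, le x x) ∧ (∀ x y z, le x y → le y z → le x z) ∧
    (∀ x y, le x y → le y x → x = y) ∧
    (∀ x x' y y', le x y → le x' y' → le (x * x') (y * y'))

/-- `F` is upward closed for the relation `le`. -/
def UpClosed {N : Type} (le : N → N → Prop) (F : Set N) : Prop :=
  ∀ s ∈ F, ∀ t, le s t → t ∈ F

/-- An ordered `C`-morphism: a surjective morphism onto a finite ordered monoid such
that preimages of upward closed sets are in `C`. -/
def IsOrderedCMorphism (C : LangClass A) {N : Type} [Monoid N]
    (η : FreeMonoid A →* N) (le : N → N → Prop) : Prop :=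
  Function.Surjective η ∧ IsCompatiblePartialOrder le ∧
    ∀ F : Set N, UpClosed le F → η ⁻¹' F ∈ C

/-- The syntactic preorder of `L`: `u ≼_L v` iff `xuy ∈ L → xvy ∈ L` for all `x, y`. -/
def SynPre (L : Lang A) (u v : FreeMonoid A) : Prop :=
  ∀ x y : FreeMonoid A, x * u * y ∈ L → x * v * y ∈ L

/-- `φ` is (a copy of) the syntactic morphism of `L`: it is surjective and identifies
exactly the words that are syntactically congruent for `L`. -/
def IsSyntacticMorphism (L : Lang A) {M : Type} [Monoid M]
    (φ : FreeMonoid A →* M) : Prop :=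
  Function.Surjective φ ∧
    ∀ u v : FreeMonoid A, φ u = φ v ↔ ∀ x y : FreeMonoid A, (x * u * y ∈ L ↔ x * v * y ∈ L)

/-- `le` is (a copy of) the syntactic order of `L` on the target of `φ`. -/
def IsSyntacticOrder (L : Lang A) {M : Type} [Monoid M] (φ : FreeMonoid A →* M)
    (le : M → M → Prop) : Prop :=
  ∀ u v : FreeMonoid A, le (φ u) (φ v) ↔ SynPre L u v

/-! ### Words -/

theorem mul_eq_mul_of_mul {A : Type} {p q u v : FreeMonoid A} {a : A}
    (h : p * q = u * FreeMonoid.of a * v) :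
    (∃ s, p = u * FreeMonoid.of a * s ∧ v = s * q) ∨
      (∃ s, u = p * s ∧ q = s * FreeMonoid.of a * v) := by
  have h' : FreeMonoid.toList p ++ FreeMonoid.toList q =
      FreeMonoid.toList u ++ (a :: FreeMonoid.toList v) := by
    have := congrArg FreeMonoid.toList h
    simpa using this
  rcases List.append_eq_append_iff.1 h' with ⟨s, h1, h2⟩ | ⟨s, h1, h2⟩
  · refine Or.inr ⟨FreeMonoid.ofList s, ?_, ?_⟩
    · apply FreeMonoid.toList.injective; simpa using h1
    · apply FreeMonoid.toList.injective; simpa using h2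
  · cases s with
    | nil =>
      refine Or.inr ⟨1, ?_, ?_⟩
      · apply FreeMonoid.toList.injective; simpa using h1.symm
      · apply FreeMonoid.toList.injective; simpa using h2.symm
    | cons b s =>
      simp only [List.cons_append, List.cons.injEq] at h2
      obtain ⟨rfl, h2⟩ := h2
      refine Or.inl ⟨FreeMonoid.ofList s, ?_, ?_⟩
      · apply FreeMonoid.toList.injective; simpa using h1
      · apply FreeMonoid.toList.injective; simpa using h2

/-- Two marked factorizations of the same word either coincide, or one marker lies strictly
to the left of the other. -/
theorem marked_eq_trichotomy {A : Type} {u v u' v' : FreeMonoid A} {a a' : A}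
    (h : u * FreeMonoid.of a * v = u' * FreeMonoid.of a' * v') :
    (u = u' ∧ a = a' ∧ v = v') ∨
      (∃ t, u' = u * FreeMonoid.of a * t ∧ v = t * FreeMonoid.of a' * v') ∨
      (∃ t, u = u' * FreeMonoid.of a' * t ∧ v' = t * FreeMonoid.of a * v) := by
  rw [mul_assoc] at h
  rcases mul_eq_mul_of_mul h with ⟨s, h1, h2⟩ | ⟨s, h1, h2⟩
  · exact Or.inr (Or.inr ⟨s, h1, by rw [h2, mul_assoc]⟩)
  · rcases mul_eq_mul_of_mul h2 with ⟨t, h3, h4⟩ | ⟨t, h3, h4⟩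
    · have h5 := congrArg FreeMonoid.toList h3
      simp only [FreeMonoid.toList_of, FreeMonoid.toList_mul, List.append_assoc,
        List.singleton_append] at h5
      have hs : FreeMonoid.toList s = [] := by
        cases hs : FreeMonoid.toList s with
        | nil => rfl
        | cons c l => rw [hs] at h5; simp at h5
      rw [hs] at h5
      simp only [List.nil_append, List.cons.injEq] at h5
      have hs1 : s = 1 := FreeMonoid.toList.injective hs
      have ht1 : t = 1 := FreeMonoid.toList.injective h5.2.symm
      subst hs1 ht1
      exact Or.inl ⟨by simpa using h1.symm, h5.1, by simpa using h4.symm⟩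
    · exact Or.inr (Or.inl ⟨t, by rw [h1, h3, mul_assoc], h4⟩)

theorem exists_left_cut {A : Type} (w : FreeMonoid A) :
    ∀ G : FreeMonoid A → Prop, G 1 → ¬ G w →
      ∃ u b v, w = u * FreeMonoid.of b * v ∧ G u ∧ ¬ G (u * FreeMonoid.of b) := by
  induction w using FreeMonoid.recOn with
  | one => intro G h h'; exact absurd h h'
  | of_mul a w ih =>
    intro G h h'
    by_cases ha : G (FreeMonoid.of a)
    · obtain ⟨u, b, v, h1, h2, h3⟩ := ih (fun u => G (FreeMonoid.of a * u)) (by simpa using ha) h'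
      exact ⟨FreeMonoid.of a * u, b, v, by rw [h1]; simp only [mul_assoc], h2,
        by simpa only [mul_assoc] using h3⟩
    · exact ⟨1, a, w, by simp, h, by simpa using ha⟩

theorem exists_right_cut {A : Type} (w : FreeMonoid A) (H : FreeMonoid A → Prop) (h : H 1)
    (hw : ¬ H w) :
    ∃ u b v, w = u * FreeMonoid.of b * v ∧ H v ∧ ¬ H (FreeMonoid.of b * v) := by
  induction w using FreeMonoid.recOn with
  | one => exact absurd h hw
  | of_mul a w ih =>
    by_cases ha : H w
    · exact ⟨1, a, w, by simp, ha, hw⟩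
    · obtain ⟨u, b, v, h1, h2, h3⟩ := ih ha
      exact ⟨FreeMonoid.of a * u, b, v, by rw [h1]; simp only [mul_assoc], h2, h3⟩

/-! ### Finite monoids -/

/-- Stability of finite monoids. -/
theorem exists_stable {N : Type} [Monoid N] [Finite N] {c a z : N} (h : c * a * z = a) :
    ∃ k, a * z ^ (k + 1) = a ∧ c ^ (k + 1) * a = a := by
  have hk : ∀ k, c ^ k * a * z ^ k = a := by
    intro k
    induction k with
    | zero => simp
    | succ k ih =>
      calc c ^ (k + 1) * a * z ^ (k + 1) = c ^ k * (c * a * z) * z ^ k := by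
            rw [pow_succ, pow_succ']; simp only [mul_assoc]
        _ = a := by rw [h, ih]
  obtain ⟨i, j, hij, hf⟩ :
      ∃ i j : ℕ, i < j ∧ ((c, z) : N × N) ^ i = (c, z) ^ j := by
    obtain ⟨i, j, hij, hf⟩ := Finite.exists_ne_map_eq_of_infinite
      (fun n : ℕ => ((c, z) : N × N) ^ n)
    rcases lt_or_gt_of_ne hij with h | h
    · exact ⟨i, j, h, hf⟩
    · exact ⟨j, i, h, hf.symm⟩
  obtain ⟨k, rfl⟩ := Nat.exists_eq_add_of_lt hij
  have hc : c ^ i = c ^ (i + k + 1) := congrArg Prod.fst hf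
  have hz : z ^ i = z ^ (i + k + 1) := congrArg Prod.snd hf
  refine ⟨k, ?_, ?_⟩
  · calc a * z ^ (k + 1) = c ^ i * a * z ^ i * z ^ (k + 1) := by rw [hk]
      _ = c ^ i * a * z ^ (i + k + 1) := by rw [mul_assoc, ← pow_add, add_assoc]
      _ = a := by rw [← hz, hk]
  · calc c ^ (k + 1) * a = c ^ (k + 1) * (c ^ i * a * z ^ i) := by rw [hk]
      _ = c ^ (i + k + 1) * a * z ^ i := by
        rw [← mul_assoc, ← mul_assoc, ← pow_add]; congr 3; omega
      _ = a := by rw [← hc, hk]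

theorem exists_pow_idempotent {M : Type} [Monoid M] [Finite M] (s : M) :
    ∃ n, s ^ (n + 1) * s ^ (n + 1) = s ^ (n + 1) := by
  obtain ⟨i, j, hij, hf⟩ : ∃ i j : ℕ, i < j ∧ s ^ i = s ^ j := by
    obtain ⟨i, j, hij, hf⟩ := Finite.exists_ne_map_eq_of_infinite (fun n : ℕ => s ^ n)
    rcases lt_or_gt_of_ne hij with h | h
    · exact ⟨i, j, h, hf⟩
    · exact ⟨j, i, h, hf.symm⟩
  obtain ⟨k, rfl⟩ := Nat.exists_eq_add_of_lt hij
  have hper : ∀ m t, s ^ (i + t + m * (k + 1)) = s ^ (i + t) := by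
    intro m t
    induction m with
    | zero => simp
    | succ m ih =>
      calc s ^ (i + t + (m + 1) * (k + 1)) = s ^ (i + k + 1) * s ^ (t + m * (k + 1)) := by
            rw [← pow_add]; congr 1; ring
        _ = s ^ (i + t) := by rw [← hf, ← pow_add, ← add_assoc, ih]
  refine ⟨i * (k + 1) + k, ?_⟩
  have := hper (i + 1) (i * k + k + 1)
  rw [← pow_add]
  convert this using 2 <;> ring

/-- In a finite monoid, `x (w x)^k` is a weak inverse of `w` for some `k`. -/
theorem exists_weak_inverse {M : Type} [Monoid M] [Finite M] (w x : M) :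
    ∃ k, x * (w * x) ^ k * w * (x * (w * x) ^ k) = x * (w * x) ^ k := by
  obtain ⟨n, hn⟩ := exists_pow_idempotent (w * x)
  refine ⟨(n + 1) + n, ?_⟩
  generalize hs : w * x = s at *
  have h3 : s ^ (n + 1) * s ^ (n + 1) * s ^ (n + 1) = s ^ (n + 1) := by rw [hn, hn]
  calc x * s ^ (n + 1 + n) * w * (x * s ^ (n + 1 + n))
      = x * (s ^ (n + 1 + n) * (w * x) * s ^ (n + 1 + n)) := by simp only [mul_assoc]
    _ = x * (s ^ (n + 1) * s ^ (n + 1) * s ^ (n + 1) * s ^ n) := by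
        rw [hs, ← pow_succ, ← pow_add, ← pow_add, ← pow_add, ← pow_add]; congr 2; ring
    _ = x * s ^ (n + 1 + n) := by rw [h3, pow_add s (n + 1) n]

/-! ### Morphisms whose fibers lie in a class -/

/-- The syntactic congruence of a language. -/
def synCon {A : Type} (L : Lang A) : Con (FreeMonoid A) where
  r u v := ∀ x y, x * u * y ∈ L ↔ x * v * y ∈ L
  iseqv := ⟨fun _ _ _ => Iff.rfl, fun h x y => (h x y).symm,
    fun h h' x y => (h x y).trans (h' x y)⟩
  mul' := by
    intro a b c d hab hcd x y
    have h1 := hab x (c * y)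
    have h2 := hcd (x * b) y
    simp only [mul_assoc] at h1 h2 ⊢
    exact h1.trans h2

theorem synCon_iff {A : Type} {L : Lang A} {u v : FreeMonoid A} :
    synCon L u v ↔ ∀ x y, x * u * y ∈ L ↔ x * v * y ∈ L := Iff.rfl

theorem finite_synCon {A : Type} {L : Lang A} {M : Type} [Monoid M] [Finite M]
    (φ : FreeMonoid A →* M) (hφ : ∀ u v, φ u = φ v → (u ∈ L ↔ v ∈ L)) :
    Finite (synCon L).Quotient := by
  have hle : Con.ker φ ≤ synCon L := by
    intro u v h x y
    have h' : φ u = φ v := h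
    exact hφ _ _ (by simp [h'])
  have : Finite (Con.ker φ).Quotient := Finite.of_injective _ (Con.kerLift_injective φ)
  refine Finite.of_surjective (Con.map _ _ hle) ?_
  intro x
  induction x using Con.induction_on with
  | H w => exact ⟨(w : (Con.ker φ).Quotient), rfl⟩

theorem iInter_mem {A : Type} {C : LangClass A} (hC : IsLatticeClass C) {ι : Type} [Finite ι]
    (f : ι → Lang A) (hf : ∀ i, f i ∈ C) : (⋂ i, f i) ∈ C := by
  classical
  have := Fintype.ofFinite ι
  have key : ∀ s : Finset ι, (⋂ i ∈ s, f i) ∈ C := by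
    intro s
    induction s using Finset.induction_on with
    | empty => simpa using hC.2.1
    | insert a s _ ih =>
      rw [Finset.set_biInter_insert]
      exact hC.2.2.2 _ _ (hf a) ih
  simpa using key Finset.univ

theorem exists_morphism_of_mem {A : Type} {C : LangClass A} (hC : IsPrevariety C) {L : Lang A}
    (hL : L ∈ C) :
    ∃ (N : Type) (_ : Monoid N) (_ : Finite N) (η : FreeMonoid A →* N),
      (∀ p, η ⁻¹' {p} ∈ C) ∧ ∀ u v, η u = η v → (u ∈ L ↔ v ∈ L) := by
  classical
  obtain ⟨hB, hq, hreg⟩ := hC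
  obtain ⟨M, _, _, φ, F, hF⟩ := hreg L hL
  have hφ : ∀ u v, φ u = φ v → (u ∈ L ↔ v ∈ L) := by
    intro u v h
    simp [hF, h]
  refine ⟨(synCon L).Quotient, inferInstance, finite_synCon φ hφ, (synCon L).mk', ?_, ?_⟩
  · intro p
    obtain ⟨u, rfl⟩ := Con.mk'_surjective p
    let ρ : M → FreeMonoid A := Function.invFun φ
    have hρ : ∀ x, φ (ρ (φ x)) = φ x := fun x => Function.invFun_eq ⟨x, rfl⟩
    have hctx : ∀ x w y, x * w * y ∈ L ↔ ρ (φ x) * w * ρ (φ y) ∈ L := by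
      intro x w y
      exact hφ _ _ (by simp [hρ])
    have hQ : ∀ x y, {w | x * w * y ∈ L} ∈ C := fun x y => (hq _ (hq L hL y).2 x).1
    have heq : ((synCon L).mk' ⁻¹' {(synCon L).mk' u} : Lang A) =
        ⋂ st : M × M, {w | ρ st.1 * w * ρ st.2 ∈ L ↔ ρ st.1 * u * ρ st.2 ∈ L} := by
      ext w
      simp only [Set.mem_preimage, Set.mem_singleton_iff, Con.coe_mk', Con.eq, Set.mem_iInter,
        Set.mem_ofPred_eq, Prod.forall, synCon_iff]
      refine ⟨fun h s t => h _ _, fun h x y => ?_⟩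
      rw [hctx x w y, hctx x u y]
      exact h _ _
    rw [heq]
    refine iInter_mem hB.1 _ ?_
    rintro ⟨s, t⟩
    by_cases h : ρ s * u * ρ t ∈ L
    · simpa [h] using hQ (ρ s) (ρ t)
    · convert hB.2 _ (hQ (ρ s) (ρ t)) using 1
      ext w
      simp [h]
  · intro u v h
    have h' : synCon L u v := (Con.eq _).1 h
    simpa using h' 1 1

/-! ### Unambiguous products and local triviality -/

/-- `L` is recognized by a morphism into a finite monoid whose idempotents `e` satisfy
`e v e ∼ e` in the contexts of `L`, whenever `v` and `e` have the same image under some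
morphism into a finite monoid with fibers in `C`. -/
def LocallyTrivialOver {A : Type} (C : LangClass A) (L : Lang A) : Prop :=
  ∃ (M : Type) (_ : Monoid M) (_ : Finite M) (φ : FreeMonoid A →* M)
    (N : Type) (_ : Monoid N) (_ : Finite N) (η : FreeMonoid A →* N),
    (∀ u v, φ u = φ v → η u = η v) ∧ (∀ u v, φ u = φ v → (u ∈ L ↔ v ∈ L)) ∧
    (∀ p, η ⁻¹' {p} ∈ C) ∧
    ∀ e v, φ (e * e) = φ e → η v = η e → ∀ x y, (x * (e * v * e) * y ∈ L ↔ x * e * y ∈ L)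

theorem prod_fiber_mem {A : Type} {C : LangClass A} (hC : IsLatticeClass C) {N₁ N₂ : Type}
    [Monoid N₁] [Monoid N₂] {η₁ : FreeMonoid A →* N₁} {η₂ : FreeMonoid A →* N₂}
    (h₁ : ∀ p, η₁ ⁻¹' {p} ∈ C) (h₂ : ∀ p, η₂ ⁻¹' {p} ∈ C) (p : N₁ × N₂) :
    (η₁.prod η₂) ⁻¹' {p} ∈ C := by
  convert hC.2.2.2 _ _ (h₁ p.1) (h₂ p.2) using 1
  ext w
  simp [Prod.ext_iff]

theorem LocallyTrivialOver.of_mem {A : Type} {C : LangClass A} (hC : IsPrevariety C)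
    {L : Lang A} (hL : L ∈ C) : LocallyTrivialOver C L := by
  obtain ⟨N, _, _, η, hη, hs⟩ := exists_morphism_of_mem hC hL
  refine ⟨N, _, ‹_›, η, N, _, ‹_›, η, fun _ _ h => h, hs, hη, fun e v he hv x y => hs _ _ ?_⟩
  rw [map_mul] at he
  simp only [map_mul, hv, he]

theorem LocallyTrivialOver.union {A : Type} {C : LangClass A} (hC : IsLatticeClass C)
    {K L : Lang A} (hK : LocallyTrivialOver C K) (hL : LocallyTrivialOver C L) :
    LocallyTrivialOver C (K ∪ L) := by
  obtain ⟨M₁, _, _, φ₁, N₁, _, _, η₁, href₁, hs₁, hC₁, ht₁⟩ := hK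
  obtain ⟨M₂, _, _, φ₂, N₂, _, _, η₂, href₂, hs₂, hC₂, ht₂⟩ := hL
  refine ⟨M₁ × M₂, inferInstance, inferInstance, φ₁.prod φ₂, N₁ × N₂, inferInstance,
    inferInstance, η₁.prod η₂, ?_, ?_, prod_fiber_mem hC hC₁ hC₂, ?_⟩
  · intro u v h
    simp only [MonoidHom.prod_apply, Prod.mk.injEq] at h ⊢
    exact ⟨href₁ _ _ h.1, href₂ _ _ h.2⟩
  · intro u v h
    simp only [MonoidHom.prod_apply, Prod.mk.injEq] at h
    exact or_congr (hs₁ _ _ h.1) (hs₂ _ _ h.2)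
  · intro e v he hv x y
    simp only [MonoidHom.prod_apply, Prod.mk.injEq] at he hv
    exact or_congr (ht₁ e v he.1 hv.1 x y) (ht₂ e v he.2 hv.2 x y)

/-- The congruence underlying the Schützenberger product of two morphisms, with respect to
the marker `a`. -/
def schutzCon {A : Type} {M₁ M₂ : Type} [Monoid M₁] [Monoid M₂] (φ₁ : FreeMonoid A →* M₁)
    (φ₂ : FreeMonoid A →* M₂) (a : A) : Con (FreeMonoid A) where
  r w w' := φ₁ w = φ₁ w' ∧ φ₂ w = φ₂ w' ∧
    ∀ s t, (∃ u v, w = u * FreeMonoid.of a * v ∧ φ₁ u = s ∧ φ₂ v = t) ↔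
      (∃ u v, w' = u * FreeMonoid.of a * v ∧ φ₁ u = s ∧ φ₂ v = t)
  iseqv := ⟨fun _ => ⟨rfl, rfl, fun _ _ => Iff.rfl⟩,
    fun h => ⟨h.1.symm, h.2.1.symm, fun s t => (h.2.2 s t).symm⟩,
    fun h h' => ⟨h.1.trans h'.1, h.2.1.trans h'.2.1, fun s t => (h.2.2 s t).trans (h'.2.2 s t)⟩⟩
  mul' := by
    have key : ∀ w x y z : FreeMonoid A, φ₁ w = φ₁ x → φ₂ y = φ₂ z →
        (∀ s t, (∃ u v, w = u * FreeMonoid.of a * v ∧ φ₁ u = s ∧ φ₂ v = t) →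
          (∃ u v, x = u * FreeMonoid.of a * v ∧ φ₁ u = s ∧ φ₂ v = t)) →
        (∀ s t, (∃ u v, y = u * FreeMonoid.of a * v ∧ φ₁ u = s ∧ φ₂ v = t) →
          (∃ u v, z = u * FreeMonoid.of a * v ∧ φ₁ u = s ∧ φ₂ v = t)) →
        ∀ s t, (∃ u v, w * y = u * FreeMonoid.of a * v ∧ φ₁ u = s ∧ φ₂ v = t) →
          (∃ u v, x * z = u * FreeMonoid.of a * v ∧ φ₁ u = s ∧ φ₂ v = t) := by
      rintro w x y z h1 h2 hw hy _ _ ⟨u, v, huv, rfl, rfl⟩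
      rcases mul_eq_mul_of_mul huv with ⟨s, hs1, hs2⟩ | ⟨s, hs1, hs2⟩
      · obtain ⟨u', v', h3, h4, h5⟩ := hw _ _ ⟨u, s, hs1, rfl, rfl⟩
        exact ⟨u', v' * z, by rw [h3]; simp only [mul_assoc], h4, by rw [hs2]; simp [h5, h2]⟩
      · obtain ⟨u', v', h3, h4, h5⟩ := hy _ _ ⟨s, v, hs2, rfl, rfl⟩
        exact ⟨x * u', v', by rw [h3]; simp only [mul_assoc], by rw [hs1]; simp [h4, h1], h5⟩
    rintro w x y z ⟨h1, h2, h3⟩ ⟨h4, h5, h6⟩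
    exact ⟨by simp [h1, h4], by simp [h2, h5], fun s t =>
      ⟨key w x y z h1 h5 (fun s t => (h3 s t).1) (fun s t => (h6 s t).1) s t,
       key x w z y h1.symm h5.symm (fun s t => (h3 s t).2) (fun s t => (h6 s t).2) s t⟩⟩

theorem finite_schutzCon {A : Type} {M₁ M₂ : Type} [Monoid M₁] [Monoid M₂] [Finite M₁]
    [Finite M₂] (φ₁ : FreeMonoid A →* M₁) (φ₂ : FreeMonoid A →* M₂) (a : A) :
    Finite (schutzCon φ₁ φ₂ a).Quotient := by
  let f : FreeMonoid A → M₁ × M₂ × Set (M₁ × M₂) := fun w =>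
    (φ₁ w, φ₂ w, {p | ∃ u v, w = u * FreeMonoid.of a * v ∧ φ₁ u = p.1 ∧ φ₂ v = p.2})
  have hf : ∀ w w', f w = f w' → schutzCon φ₁ φ₂ a w w' := by
    intro w w' h
    simp only [f, Prod.mk.injEq, Set.ext_iff, Prod.forall, Set.mem_ofPred_eq] at h
    exact h
  refine Finite.of_injective (fun x : (schutzCon φ₁ φ₂ a).Quotient => f x.out) ?_
  intro x y h
  have := hf _ _ h
  rw [← Quotient.out_eq x, ← Quotient.out_eq y]
  exact (Con.eq _).2 this

theorem LocallyTrivialOver.markedCat {A : Type} {C : LangClass A} (hC : IsLatticeClass C)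
    {K L : Lang A} {a : A} (hK : LocallyTrivialOver C K) (hL : LocallyTrivialOver C L)
    (hU : Unambiguous K a L) : LocallyTrivialOver C (MarkedCat K a L) := by
  obtain ⟨M₁, _, _, φ₁, N₁, _, _, η₁, href₁, hs₁, hC₁, ht₁⟩ := hK
  obtain ⟨M₂, _, _, φ₂, N₂, _, _, η₂, href₂, hs₂, hC₂, ht₂⟩ := hL
  have hφ : ∀ u v, (schutzCon φ₁ φ₂ a).mk' u = (schutzCon φ₁ φ₂ a).mk' v →
      schutzCon φ₁ φ₂ a u v := fun u v h => (Con.eq _).1 h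
  have hsat : ∀ u v, (schutzCon φ₁ φ₂ a).mk' u = (schutzCon φ₁ φ₂ a).mk' v →
      u ∈ MarkedCat K a L → v ∈ MarkedCat K a L := by
    rintro w w' h ⟨u, hu, v, hv, huv⟩
    obtain ⟨u', v', h1, h2, h3⟩ := ((hφ _ _ h).2.2 _ _).1 ⟨u, v, huv, rfl, rfl⟩
    exact ⟨u', (hs₁ _ _ h2).2 hu, v', (hs₂ _ _ h3).2 hv, h1⟩
  have hsat' : ∀ u v, (schutzCon φ₁ φ₂ a).mk' u = (schutzCon φ₁ φ₂ a).mk' v →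
      (u ∈ MarkedCat K a L ↔ v ∈ MarkedCat K a L) :=
    fun u v h => ⟨hsat u v h, hsat v u h.symm⟩
  refine ⟨(schutzCon φ₁ φ₂ a).Quotient, inferInstance, finite_schutzCon φ₁ φ₂ a,
    (schutzCon φ₁ φ₂ a).mk', N₁ × N₂, inferInstance, inferInstance, η₁.prod η₂, ?_, hsat',
    prod_fiber_mem hC hC₁ hC₂, ?_⟩
  · intro u v h
    have h' := hφ u v h
    simp only [MonoidHom.prod_apply, Prod.mk.injEq]
    exact ⟨href₁ _ _ h'.1, href₂ _ _ h'.2.1⟩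
  · intro e v he hv x y
    have hee := hφ _ _ he
    have he₁ : φ₁ e * φ₁ e = φ₁ e := by simpa using hee.1
    have he₂ : φ₂ e * φ₂ e = φ₂ e := by simpa using hee.2.1
    have hη₁ : η₁ e * η₁ e = η₁ e := by simpa using href₁ _ _ hee.1
    have hη₂ : η₂ e * η₂ e = η₂ e := by simpa using href₂ _ _ hee.2.1
    simp only [MonoidHom.prod_apply, Prod.mk.injEq] at hv
    have htK : ∀ z, η₁ z = η₁ e → ∀ x y, (x * (e * z * e) * y ∈ K ↔ x * e * y ∈ K) :=
      fun z hz => ht₁ e z hee.1 hz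
    have htL : ∀ z, η₂ z = η₂ e → ∀ x y, (x * (e * z * e) * y ∈ L ↔ x * e * y ∈ L) :=
      fun z hz => ht₂ e z hee.2.1 hz
    have hclash : ∀ g h, η₁ (g * FreeMonoid.of a * h) = η₁ e →
        η₂ (g * FreeMonoid.of a * h) = η₂ e → x * e * g ∈ K → h * e * y ∈ L → False := by
      intro g h h1 h2 hg hh
      have h3 := (htK _ h1 x g).2 hg
      have h4 := (htL _ h2 h y).2 hh
      have h5 := (hU _ _ _ _ hg h3 h4 hh (by simp only [mul_assoc])).1
      have h6 := congrArg FreeMonoid.length h5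
      simp only [FreeMonoid.length_mul, FreeMonoid.length_of] at h6
      omega
    -- Membership does not depend on the factor `z`.
    have main : ∀ z, η₁ z = η₁ e → η₂ z = η₂ e →
        (x * (e * ((e * z * e) * (e * y))) ∈ MarkedCat K a L ↔
          ((∃ x₁ x₂, x = x₁ * FreeMonoid.of a * x₂ ∧ x₁ ∈ K ∧ x₂ * e * y ∈ L) ∨
           (∃ g h, e = g * FreeMonoid.of a * h ∧ x * g ∈ K ∧ h * e * y ∈ L) ∨
           (∃ g h, e = g * FreeMonoid.of a * h ∧ x * e * g ∈ K ∧ h * y ∈ L) ∨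
           (∃ y₁ y₂, y = y₁ * FreeMonoid.of a * y₂ ∧ x * e * y₁ ∈ K ∧ y₂ ∈ L))) := by
      intro z hz₁ hz₂
      have hw₁ : η₁ (e * z * e) = η₁ e := by simp [hz₁, hη₁]
      have hw₂ : η₂ (e * z * e) = η₂ e := by simp [hz₂, hη₂]
      have e1 : ∀ t, t * (e * ((e * z * e) * (e * y))) ∈ L ↔ t * e * y ∈ L := by
        intro t
        simpa only [mul_assoc] using htL _ hw₂ t y
      have e2 : ∀ t, t * ((e * z * e) * (e * y)) ∈ L ↔ t * e * y ∈ L := by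
        intro t
        have h1 := htL _ hz₂ t (e * y)
        rw [← hs₂ (t * e * y) (t * e * (e * y))
          (by simp only [map_mul, mul_assoc]; rw [← mul_assoc (φ₂ e) (φ₂ e), he₂])] at h1
        simpa only [mul_assoc] using h1
      have e3 : ∀ t, x * (e * ((e * z * e) * t)) ∈ K ↔ x * e * t ∈ K := by
        intro t
        have h1 := htK _ hz₁ (x * e) t
        rw [← hs₁ (x * e * t) (x * e * e * t)
          (by simp only [map_mul, mul_assoc]; rw [← mul_assoc (φ₁ e) (φ₁ e), he₁])] at h1
        simpa only [mul_assoc] using h1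
      have e4 : ∀ t, x * (e * ((e * z * e) * (e * t))) ∈ K ↔ x * e * t ∈ K := by
        intro t
        simpa only [mul_assoc] using htK _ hw₁ x t
      constructor
      · rintro ⟨u, hu, t, ht, hut⟩
        rcases mul_eq_mul_of_mul hut with ⟨s, h1, h2⟩ | ⟨s, h1, h2⟩
        · exact Or.inl ⟨u, s, h1, hu, (e1 s).1 (h2 ▸ ht)⟩
        rcases mul_eq_mul_of_mul h2 with ⟨s', h3, h4⟩ | ⟨s', h3, h4⟩
        · exact Or.inr (Or.inl ⟨s, s', h3, h1 ▸ hu, (e2 s').1 (h4 ▸ ht)⟩)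
        rcases mul_eq_mul_of_mul h4 with ⟨s'', h5, h6⟩ | ⟨s'', h5, h6⟩
        · refine (hclash s' s'' (h5 ▸ hw₁) (h5 ▸ hw₂) ?_ ?_).elim
          · rw [mul_assoc, ← h3, ← h1]; exact hu
          · rw [mul_assoc, ← h6]; exact ht
        have hu' : u = x * (e * ((e * z * e) * s'')) := by rw [h1, h3, h5]
        rcases mul_eq_mul_of_mul h6 with ⟨s₃, h7, h8⟩ | ⟨s₃, h7, h8⟩
        · exact Or.inr (Or.inr (Or.inl ⟨s'', s₃, h7, (e3 s'').1 (hu' ▸ hu), h8 ▸ ht⟩))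
        · exact Or.inr (Or.inr (Or.inr ⟨s₃, t, h8, (e4 s₃).1 (by rw [← h7, ← hu']; exact hu),
            ht⟩))
      · rintro (⟨x₁, x₂, h1, h2, h3⟩ | ⟨g, h, h1, h2, h3⟩ | ⟨g, h, h1, h2, h3⟩ |
          ⟨y₁, y₂, h1, h2, h3⟩)
        · exact ⟨x₁, h2, _, (e1 x₂).2 h3, by nth_rw 1 [h1]; simp only [mul_assoc]⟩
        · exact ⟨_, h2, _, (e2 h).2 h3, by nth_rw 1 [h1]; simp only [mul_assoc]⟩
        · refine ⟨_, (e3 g).2 h2, _, h3, ?_⟩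
          have : e * y = g * FreeMonoid.of a * h * y := by rw [← h1]
          rw [this]
          simp only [mul_assoc]
        · refine ⟨_, (e4 y₁).2 h2, _, h3, ?_⟩
          rw [h1]
          simp only [mul_assoc]
    have hmk : ∀ t : (schutzCon φ₁ φ₂ a).Quotient, (schutzCon φ₁ φ₂ a).mk' e *
        ((schutzCon φ₁ φ₂ a).mk' e * t) = (schutzCon φ₁ φ₂ a).mk' e * t := by
      intro t
      rw [← mul_assoc, ← map_mul, he]
    rw [hsat' (x * (e * v * e) * y) (x * (e * ((e * v * e) * (e * y))))
        (by simp only [map_mul, mul_assoc, hmk]),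
      hsat' (x * e * y) (x * (e * ((e * e * e) * (e * y))))
        (by simp only [map_mul, mul_assoc, hmk]),
      main v hv.1 hv.2, main e rfl rfl]

theorem UPol.locallyTrivialOver {A : Type} {C : LangClass A} (hC : IsPrevariety C)
    {L : Lang A} (hL : UPol C L) : LocallyTrivialOver C L := by
  induction hL with
  | base h => exact .of_mem hC h
  | disjUnion _ _ _ ihK ihL => exact ihK.union hC.1.1 ihL
  | mcat a _ _ hU ihK ihL => exact ihK.markedCat hC.1.1 ihL hU

/-- A locally trivial extension of morphisms: `α` refines `η` and `e v e = e` for idempotents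
`e` and `v` in the same fiber of `η`. -/
structure IsLocallyTrivialExt {A M N : Type} [Monoid M] [Monoid N] (α : FreeMonoid A →* M)
    (η : FreeMonoid A →* N) : Prop where
  refines : ∀ {u v}, α u = α v → η u = η v
  idem : ∀ {e v}, α (e * e) = α e → η v = η e → α (e * v * e) = α e

theorem LocallyTrivialOver.exists_ext {A : Type} {C : LangClass A} {L : Lang A}
    (hL : LocallyTrivialOver C L) :
    ∃ (M : Type) (_ : Monoid M) (_ : Finite M) (α : FreeMonoid A →* M)
      (N : Type) (_ : Monoid N) (_ : Finite N) (η : FreeMonoid A →* N),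
      IsLocallyTrivialExt α η ∧ (∀ p, η ⁻¹' {p} ∈ C) ∧
        ∀ u v, α u = α v → (u ∈ L ↔ v ∈ L) := by
  obtain ⟨M, _, _, φ, N, _, _, η, href, hs, hη, ht⟩ := hL
  have := finite_synCon φ hs
  refine ⟨(synCon L).Quotient × N, inferInstance, inferInstance, (synCon L).mk'.prod η, N, _,
    ‹_›, η, ⟨?_, ?_⟩, hη, ?_⟩
  · intro u v h
    exact (Prod.ext_iff.1 h).2
  · intro e v he hv
    obtain ⟨h1, h2⟩ := Prod.ext_iff.1 he
    have h1 : (synCon L).mk' e * (synCon L).mk' e = (synCon L).mk' e := by simpa using h1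
    have h2 : η e * η e = η e := by simpa using h2
    refine Prod.ext ?_ (by simp [hv, h2])
    obtain ⟨n, hn⟩ := exists_pow_idempotent (φ e)
    have p1 : (synCon L).mk' (e ^ (n + 1)) = (synCon L).mk' e := by
      rw [map_pow]; exact IsIdempotentElem.pow_succ_eq n h1
    have p2 : η (e ^ (n + 1)) = η e := by
      rw [map_pow]; exact IsIdempotentElem.pow_succ_eq n h2
    have h3 : (synCon L).mk' (e ^ (n + 1) * v * e ^ (n + 1)) = (synCon L).mk' (e ^ (n + 1)) :=
      (Con.eq _).2 (ht (e ^ (n + 1)) v (by simpa using hn) (hv.trans p2.symm))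
    rw [map_mul, map_mul, p1] at h3
    change (synCon L).mk' (e * v * e) = (synCon L).mk' e
    rw [map_mul, map_mul]
    exact h3
  · intro u v h
    have h' : synCon L u v := (Con.eq _).1 (Prod.ext_iff.1 h).1
    simpa using h' 1 1

/-! ### Weak alternated products -/

theorem WAPol.of_finite_cover {A : Type} {C : LangClass A} (hC : IsLatticeClass C) {ι : Type}
    [Finite ι] (S : Lang A) (R : ι → Lang A) (hcov : ∀ w ∈ S, ∃ i, w ∈ R i)
    (hsub : ∀ i, R i ⊆ S) (hdisj : ∀ i j w, w ∈ R i → w ∈ R j → i = j)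
    (hR : ∀ i, WAPol C (R i)) : WAPol C S := by
  classical
  have := Fintype.ofFinite ι
  have key : ∀ s : Finset ι, WAPol C (⋃ i ∈ s, R i) := by
    intro s
    induction s using Finset.induction_on with
    | empty => simpa using WAPol.base hC.1
    | insert a s ha ih =>
      rw [Finset.set_biUnion_insert]
      refine WAPol.disjUnion (hR a) ih ?_
      ext w
      simp only [Set.mem_inter_iff, Set.mem_iUnion, Set.mem_empty_iff_false, iff_false]
      rintro ⟨h1, i, hi, h2⟩
      exact ha (hdisj _ _ _ h1 h2 ▸ hi)
  have heq : S = ⋃ i ∈ (Finset.univ : Finset ι), R i := by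
    ext w
    simp only [Finset.mem_univ, Set.iUnion_true, Set.mem_iUnion]
    exact ⟨hcov w, fun ⟨i, hi⟩ => hsub i hi⟩
  rw [heq]
  exact key _

theorem WAPol.of_fibers {A : Type} {C : LangClass A} (hC : IsLatticeClass C) {ι : Type}
    [Finite ι] (S : Lang A) (κ : FreeMonoid A → ι)
    (h : ∀ i, WAPol C {w | w ∈ S ∧ κ w = i}) : WAPol C S :=
  .of_finite_cover hC S (fun i => {w | w ∈ S ∧ κ w = i}) (fun w hw => ⟨κ w, hw, rfl⟩)
    (fun _ _ hw => hw.1) (fun _ _ _ h1 h2 => h1.2.symm.trans h2.2) h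

section Ext

variable {A M N : Type} [Monoid M] [Monoid N]

/-- `q u` is `R`-equivalent to `q` in the image of `α`. -/
def RStays (α : FreeMonoid A →* M) (q u : FreeMonoid A) : Prop := ∃ x, α (q * u * x) = α q

/-- `u r` is `L`-equivalent to `r` in the image of `α`. -/
def LStays (α : FreeMonoid A →* M) (r u : FreeMonoid A) : Prop := ∃ y, α (y * u * r) = α r

/-- `w` is `J`-below `u` in the image of `η`. -/
def JBelow (η : FreeMonoid A →* N) (w u : FreeMonoid A) : Prop := ∃ x y, η (x * u * y) = η w

/-- The number of elements that are `J`-above `w`. -/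
noncomputable def jDepth (η : FreeMonoid A →* N) (w : FreeMonoid A) : ℕ :=
  {p | ∃ u, η u = p ∧ JBelow η w u}.ncard

/-- The cardinality of the right ideal generated by `q`. -/
noncomputable def rSize (α : FreeMonoid A →* M) (q : FreeMonoid A) : ℕ :=
  {m | ∃ x, α (q * x) = m}.ncard

/-- The cardinality of the left ideal generated by `r`. -/
noncomputable def lSize (α : FreeMonoid A →* M) (r : FreeMonoid A) : ℕ :=
  {m | ∃ x, α (x * r) = m}.ncard

theorem RStays.one (α : FreeMonoid A →* M) (q : FreeMonoid A) : RStays α q 1 := ⟨1, by simp⟩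

theorem LStays.one (α : FreeMonoid A →* M) (r : FreeMonoid A) : LStays α r 1 := ⟨1, by simp⟩

theorem RStays.left {α : FreeMonoid A →* M} {q u v : FreeMonoid A} (h : RStays α q (u * v)) :
    RStays α q u := by
  obtain ⟨x, hx⟩ := h
  exact ⟨v * x, by simpa only [mul_assoc] using hx⟩

theorem LStays.right {α : FreeMonoid A →* M} {r u v : FreeMonoid A} (h : LStays α r (u * v)) :
    LStays α r v := by
  obtain ⟨x, hx⟩ := h
  exact ⟨x * u, by simpa only [mul_assoc] using hx⟩

theorem RStays.congr {α : FreeMonoid A →* M} {q u v : FreeMonoid A} (h : RStays α q u)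
    (huv : α u = α v) : RStays α q v := by
  obtain ⟨x, hx⟩ := h
  exact ⟨x, by simpa [huv] using hx⟩

theorem LStays.congr {α : FreeMonoid A →* M} {r u v : FreeMonoid A} (h : LStays α r u)
    (huv : α u = α v) : LStays α r v := by
  obtain ⟨x, hx⟩ := h
  exact ⟨x, by simpa [huv] using hx⟩

theorem JBelow.refl (η : FreeMonoid A →* N) (w : FreeMonoid A) : JBelow η w w :=
  ⟨1, 1, by simp⟩

theorem JBelow.trans {η : FreeMonoid A →* N} {u v w : FreeMonoid A} (h : JBelow η u v)
    (h' : JBelow η v w) : JBelow η u w := by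
  obtain ⟨x, y, h⟩ := h
  obtain ⟨x', y', h'⟩ := h'
  refine ⟨x * x', y' * y, ?_⟩
  rw [← h]
  simp only [map_mul] at h' ⊢
  rw [← h']
  simp only [mul_assoc]

theorem IsLocallyTrivialExt.swap_fiber {α : FreeMonoid A →* M} {η : FreeMonoid A →* N}
    (h : IsLocallyTrivialExt α η) {w w' x : FreeMonoid A} (hx : α (x * w * x) = α x)
    (hw : η w' = η w) : α (w * x * w' * x * w) = α (w * x * w) := by
  have hid : α (x * w * (x * w)) = α (x * w) := by
    rw [← mul_assoc, map_mul, hx, map_mul]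
  have h1 := h.idem (v := x * w') hid (by simp [hw])
  calc α (w * x * w' * x * w) = α w * α (x * w * x) * α (w' * x * w) := by
        rw [hx]; simp [mul_assoc]
    _ = α w * α (x * w * (x * w') * (x * w)) := by simp only [map_mul, mul_assoc]
    _ = α (w * x * w) := by rw [h1]; simp [mul_assoc]

theorem leftCDeterministic_of_fiber {C : LangClass A} (hC : IsLatticeClass C)
    {η : FreeMonoid A →* N} (hη : ∀ p, η ⁻¹' {p} ∈ C) {K L : Lang A} {u : FreeMonoid A} {b : A}
    (hK : ∀ w ∈ K, η w = η u) (hne : ∀ z, η (u * FreeMonoid.of b * z) ≠ η u) :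
    LeftCDeterministic C K b L := by
  refine ⟨_, hη (η u), _, hC.2.1, hK, Set.subset_univ _, ?_⟩
  ext w
  simp only [Set.mem_inter_iff, Set.mem_empty_iff_false, iff_false]
  rintro ⟨h1, u', h2, z, -, rfl⟩
  refine hne z ?_
  have h2' : η u' = η u := h2
  have h1' : η (u' * FreeMonoid.of b * z) = η u := h1
  rw [← h1']
  simp [h2']

theorem rightCDeterministic_of_fiber {C : LangClass A} (hC : IsLatticeClass C)
    {η : FreeMonoid A →* N} (hη : ∀ p, η ⁻¹' {p} ∈ C) {K L : Lang A} {v : FreeMonoid A} {b : A}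
    (hL : ∀ w ∈ L, η w = η v) (hne : ∀ z, η (z * (FreeMonoid.of b * v)) ≠ η v) :
    RightCDeterministic C K b L := by
  refine ⟨_, hC.2.1, _, hη (η v), Set.subset_univ _, hL, ?_⟩
  ext w
  simp only [Set.mem_inter_iff, Set.mem_empty_iff_false, iff_false]
  rintro ⟨h1, z, -, v', h2, rfl⟩
  refine hne z ?_
  have h2' : η v' = η v := h2
  have h1' : η (z * FreeMonoid.of b * v') = η v := h1
  rw [← h1']
  simp [h2', mul_assoc]

variable [Finite M]

theorem rSize_lt {α : FreeMonoid A →* M} {q z : FreeMonoid A} (h : ¬ RStays α q z) :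
    rSize α (q * z) < rSize α q := by
  refine Set.ncard_lt_ncard ⟨?_, fun hsub => h ?_⟩ (Set.toFinite _)
  · rintro _ ⟨x, rfl⟩
    exact ⟨z * x, by simp only [mul_assoc]⟩
  · exact hsub ⟨1, by rw [mul_one]⟩

theorem lSize_lt {α : FreeMonoid A →* M} {r z : FreeMonoid A} (h : ¬ LStays α r z) :
    lSize α (z * r) < lSize α r := by
  refine Set.ncard_lt_ncard ⟨?_, fun hsub => h ?_⟩ (Set.toFinite _)
  · rintro _ ⟨x, rfl⟩
    exact ⟨x * z, by simp only [mul_assoc]⟩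
  · obtain ⟨y, hy⟩ := hsub ⟨1, by rw [one_mul]⟩
    exact ⟨y, by rwa [mul_assoc]⟩

theorem RStays.exists_weak_inverse {α : FreeMonoid A →* M} {q w : FreeMonoid A}
    (h : RStays α q w) : ∃ x, α (q * w * x) = α q ∧ α (x * w * x) = α x := by
  obtain ⟨x, hx⟩ := h
  obtain ⟨k, hk⟩ := RegLang.exists_weak_inverse (α w) (α x)
  refine ⟨x * (w * x) ^ k, ?_, by simpa [mul_assoc] using hk⟩
  have hpow : ∀ n, α q * (α w * α x) ^ n = α q := by
    intro n
    induction n with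
    | zero => simp
    | succ n ih =>
      rw [pow_succ, ← mul_assoc, ih]
      simpa [mul_assoc] using hx
  calc α (q * w * (x * (w * x) ^ k)) = α q * (α w * α x) ^ (k + 1) := by
        rw [pow_succ']; simp [mul_assoc]
    _ = α q := hpow _

theorem LStays.exists_weak_inverse {α : FreeMonoid A →* M} {r w : FreeMonoid A}
    (h : LStays α r w) : ∃ y, α (y * w * r) = α r ∧ α (y * w * y) = α y := by
  obtain ⟨y, hy⟩ := h
  obtain ⟨k, hk⟩ := RegLang.exists_weak_inverse (α w) (α y)
  refine ⟨y * (w * y) ^ k, ?_, by simpa [mul_assoc] using hk⟩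
  have hy' : α y * (α w * α r) = α r := by simpa [mul_assoc] using hy
  have hpow : ∀ n, (α w * α y) ^ n * (α w * α r) = α w * α r := by
    intro n
    induction n with
    | zero => simp
    | succ n ih => rw [pow_succ, mul_assoc, mul_assoc (α w), hy', ih]
  simp only [map_mul, map_pow, mul_assoc, hpow, hy']

theorem IsLocallyTrivialExt.rStays {α : FreeMonoid A →* M} {η : FreeMonoid A →* N}
    (h : IsLocallyTrivialExt α η) {q w w' : FreeMonoid A} (hq : RStays α q w)
    (hw : η w' = η w) : RStays α q w' := by
  obtain ⟨x, hx1, hx2⟩ := hq.exists_weak_inverse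
  refine ⟨x * w * x, ?_⟩
  calc α (q * w' * (x * w * x)) = α (q * w * x) * α (w' * (x * w * x)) := by
        rw [hx1]; simp only [map_mul, mul_assoc]
    _ = α q * α (w * x * w' * x * w) * α x := by simp only [map_mul, mul_assoc]
    _ = α (q * w * x) * α (w * x) := by
        rw [h.swap_fiber hx2 hw]; simp only [map_mul, mul_assoc]
    _ = α q := by rw [hx1, ← map_mul, ← mul_assoc, hx1]

theorem IsLocallyTrivialExt.lStays {α : FreeMonoid A →* M} {η : FreeMonoid A →* N}
    (h : IsLocallyTrivialExt α η) {r w w' : FreeMonoid A} (hr : LStays α r w)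
    (hw : η w' = η w) : LStays α r w' := by
  obtain ⟨y, hy1, hy2⟩ := hr.exists_weak_inverse
  refine ⟨y * w * y, ?_⟩
  calc α (y * w * y * w' * r) = α (y * w * y * w') * α (y * w * r) := by
        rw [hy1]; simp only [map_mul]
    _ = α y * α (w * y * w' * y * w) * α r := by simp only [map_mul, mul_assoc]
    _ = α (y * w) * α (y * w * r) := by
        rw [h.swap_fiber hy2 hw]; simp only [map_mul, mul_assoc]
    _ = α r := by rw [hy1, ← map_mul, hy1]

/-- Along the first letter that leaves the `R`-class of `q`, the `R`-class strictly drops in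
the image of `η`. -/
theorem IsLocallyTrivialExt.ne_of_left_cut {α : FreeMonoid A →* M} {η : FreeMonoid A →* N}
    (h : IsLocallyTrivialExt α η) {q u : FreeMonoid A} {b : A} (hu : RStays α q u)
    (hub : ¬ RStays α q (u * FreeMonoid.of b)) (z : FreeMonoid A) :
    η (u * FreeMonoid.of b * z) ≠ η u :=
  fun hz => hub (h.rStays hu hz).left

theorem IsLocallyTrivialExt.ne_of_right_cut {α : FreeMonoid A →* M} {η : FreeMonoid A →* N}
    (h : IsLocallyTrivialExt α η) {r v : FreeMonoid A} {b : A} (hv : LStays α r v)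
    (hbv : ¬ LStays α r (FreeMonoid.of b * v)) (z : FreeMonoid A) :
    η (z * (FreeMonoid.of b * v)) ≠ η v :=
  fun hz => hbv (h.lStays hv hz).right

variable [Finite N]

theorem jDepth_le {η : FreeMonoid A →* N} {w u : FreeMonoid A} (h : JBelow η w u) :
    jDepth η u ≤ jDepth η w :=
  Set.ncard_le_ncard (fun _ ⟨v, hv, hu⟩ => ⟨v, hv, h.trans hu⟩) (Set.toFinite _)

theorem JBelow.symm_of_not_lt {η : FreeMonoid A →* N} {w u : FreeMonoid A} (h : JBelow η w u)
    (hlt : ¬ jDepth η u < jDepth η w) : JBelow η u w := by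
  have hsub : {p | ∃ v, η v = p ∧ JBelow η u v} ⊆ {p | ∃ v, η v = p ∧ JBelow η w v} :=
    fun _ ⟨v, hv, hu⟩ => ⟨v, hv, h.trans hu⟩
  have heq := Set.eq_of_subset_of_ncard_le hsub (not_lt.1 hlt) (Set.toFinite _)
  have hw : η w ∈ {p | ∃ v, η v = p ∧ JBelow η w v} := ⟨w, rfl, .refl η w⟩
  rw [← heq] at hw
  obtain ⟨v, hv, x, y, hxy⟩ := hw
  exact ⟨x, y, by rw [← hxy]; simp [hv]⟩

theorem IsLocallyTrivialExt.const_on_fiber {α : FreeMonoid A →* M} {η : FreeMonoid A →* N}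
    (h : IsLocallyTrivialExt α η) {q r w w' : FreeMonoid A} (hq : RStays α q w)
    (hr : LStays α r w) (hqw : JBelow η w (q * w)) (hwr : JBelow η w (w * r))
    (hw : η w' = η w) : α (q * w' * r) = α (q * w * r) := by
  obtain ⟨x, hx1, hx2⟩ := hq.exists_weak_inverse
  obtain ⟨y, hy1, hy2⟩ := hr.exists_weak_inverse
  have reg : ∀ z c d : FreeMonoid A, α (z * w * z) = α z → η (c * z * w * d) = η w →
      η w * η z * η w = η w := by
    intro z c d hz hc
    have hz' := h.refines hz
    simp only [map_mul] at hz'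
    obtain ⟨k, -, hk⟩ := exists_stable (c := η (c * z)) (a := η w) (z := η d)
      (by simpa [mul_assoc] using hc)
    rw [pow_succ] at hk
    have hk' : η w = η (c * z) ^ k * η c * (η z * η w) := by
      conv_lhs => rw [← hk]
      simp only [map_mul, mul_assoc]
    calc η w * η z * η w = η w * (η z * η w) := mul_assoc _ _ _
      _ = η (c * z) ^ k * η c * (η z * η w) * (η z * η w) := congrArg (· * (η z * η w)) hk'
      _ = η (c * z) ^ k * η c * (η z * η w * η z) * η w := by simp only [mul_assoc]
      _ = η (c * z) ^ k * η c * (η z * η w) := by rw [hz']; simp only [mul_assoc]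
      _ = η w := hk'.symm
  have hpx : η w * η x * η w = η w := by
    obtain ⟨c, d, hcd⟩ := hqw
    refine reg x (c * q * w) d hx2 ?_
    have := h.refines hx1
    simp only [map_mul] at this hcd ⊢
    have e : η c * (η q * η w * η x) * η w * η d = η w := by
      rw [this]
      simpa only [mul_assoc] using hcd
    simpa only [mul_assoc] using e
  have hpy : η w * η y * η w = η w := by
    obtain ⟨c, d, hcd⟩ := hwr
    refine reg y (c * w) (r * d) hy2 ?_
    have := h.refines hy1
    simp only [map_mul] at this hcd ⊢
    have e : η c * η w * (η y * η w * η r) * η d = η w := by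
      rw [this]
      simpa only [mul_assoc] using hcd
    simpa only [mul_assoc] using e
  have hid : α (y * w * (y * w)) = α (y * w) := by
    rw [← mul_assoc, map_mul, hy2, map_mul]
  have hf : α (y * w * (x * w) * (y * w)) = α (y * w) := by
    have h1 := h.idem (v := y * w * (x * w)) hid
      (by simp only [map_mul, mul_assoc] at hpx ⊢; rw [hpx])
    calc α (y * w * (x * w) * (y * w))
        = α (y * w * (y * w)) * α (x * w * (y * w)) := by
          rw [hid]; simp only [map_mul, mul_assoc]
      _ = α (y * w) := by
          rw [← h1]; simp only [map_mul, mul_assoc]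
  have hsw := h.swap_fiber (w' := w' * (y * w)) hx2
    (by simp only [map_mul, mul_assoc] at hpy ⊢; rw [hw, hpy])
  calc α (q * w' * r) = α (q * w * x) * α w' * α (y * w * r) := by
        rw [hx1, hy1]; simp only [map_mul]
    _ = α (q * w * x) * α w' * α (y * w) * α r := by simp only [map_mul, mul_assoc]
    _ = α q * α (w * x * (w' * (y * w)) * x * w) * α (y * w * r) := by
        rw [← hf]; simp only [map_mul, mul_assoc]
    _ = α (q * w * x) * α w * α (y * w * r) := by rw [hsw]; simp only [map_mul, mul_assoc]
    _ = α (q * w * r) := by rw [hx1, hy1]; simp only [map_mul]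

theorem jDepth_lt_of_left_cut {η : FreeMonoid A →* N} {u v w : FreeMonoid A} {b : A}
    (hw : η (u * FreeMonoid.of b * v) = η w)
    (hne : ∀ z, η (u * FreeMonoid.of b * z) ≠ η u) : jDepth η u < jDepth η w := by
  by_contra hlt
  have hJ : JBelow η w u := ⟨1, FreeMonoid.of b * v, by simpa [mul_assoc] using hw⟩
  obtain ⟨x, y, hxy⟩ := hJ.symm_of_not_lt hlt
  obtain ⟨k, hk, -⟩ := exists_stable (c := η x) (a := η u) (z := η (FreeMonoid.of b * v * y))
    (by
      rw [map_mul, map_mul, ← hw] at hxy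
      simpa only [map_mul, mul_assoc] using hxy)
  refine hne (v * y * (FreeMonoid.of b * v * y) ^ k) ?_
  rw [pow_succ'] at hk
  simpa only [map_mul, map_pow, mul_assoc] using hk

theorem jDepth_lt_of_right_cut {η : FreeMonoid A →* N} {u v w : FreeMonoid A} {b : A}
    (hw : η (u * FreeMonoid.of b * v) = η w)
    (hne : ∀ z, η (z * (FreeMonoid.of b * v)) ≠ η v) : jDepth η v < jDepth η w := by
  by_contra hlt
  have hJ : JBelow η w v := ⟨u * FreeMonoid.of b, 1, by simpa [mul_assoc] using hw⟩
  obtain ⟨x, y, hxy⟩ := hJ.symm_of_not_lt hlt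
  obtain ⟨k, -, hk⟩ := exists_stable (c := η (x * u * FreeMonoid.of b)) (a := η v) (z := η y)
    (by
      rw [map_mul, map_mul, ← hw] at hxy
      simpa only [map_mul, mul_assoc] using hxy)
  refine hne ((x * u * FreeMonoid.of b) ^ k * (x * u)) ?_
  rw [pow_succ] at hk
  simpa only [map_mul, map_pow, mul_assoc] using hk

theorem WAPol.fiber_of_left_cut [Finite A] {C : LangClass A} (hC : IsLatticeClass C)
    {α : FreeMonoid A →* M} {η : FreeMonoid A →* N} (h : IsLocallyTrivialExt α η)
    (hη : ∀ p, η ⁻¹' {p} ∈ C) {q r w₀ : FreeMonoid A}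
    (ihJ : ∀ w, jDepth η w < jDepth η w₀ → ∀ m, WAPol C {v | η v = η w ∧ α v = m})
    (ihR : ∀ z v, ¬ RStays α q z → η (z * v) = η w₀ → JBelow η v w₀ →
      ∀ m, WAPol C {v' | η v' = η v ∧ α (q * z * v' * r) = m})
    (hq : ¬ RStays α q w₀) (m : M) :
    WAPol C {w | η w = η w₀ ∧ α (q * w * r) = m} := by
  refine .of_finite_cover hC _ (fun i : A × M × N => {w | ∃ u v, w = u * FreeMonoid.of i.1 * v ∧
    α u = i.2.1 ∧ η v = i.2.2 ∧ RStays α q u ∧ ¬ RStays α q (u * FreeMonoid.of i.1) ∧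
    η w = η w₀ ∧ α (q * w * r) = m}) ?_ ?_ ?_ ?_
  · rintro w ⟨hw, hm⟩
    obtain ⟨u, b, v, rfl, h1, h2⟩ := exists_left_cut w (RStays α q) (.one α q)
      (fun hw' => hq (h.rStays hw' hw.symm))
    exact ⟨(b, α u, η v), u, v, rfl, rfl, rfl, h1, h2, hw, hm⟩
  · rintro i w ⟨u, v, -, -, -, -, -, h1, h2⟩
    exact ⟨h1, h2⟩
  · rintro ⟨b, s, p⟩ ⟨b', s', p'⟩ w ⟨u, v, hw, rfl, rfl, h1, h2, -, -⟩
      ⟨u', v', hw', rfl, rfl, h1', h2', -, -⟩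
    rcases marked_eq_trichotomy (hw.symm.trans hw') with ⟨rfl, rfl, rfl⟩ | ⟨t, ht, -⟩ |
      ⟨t, ht, -⟩
    · rfl
    · exact (h2 (ht ▸ h1').left).elim
    · exact (h2' (ht ▸ h1).left).elim
  · rintro ⟨b, s, p⟩
    by_cases hex : ∃ u v, α u = s ∧ η v = p ∧ RStays α q u ∧
        ¬ RStays α q (u * FreeMonoid.of b) ∧ η (u * FreeMonoid.of b * v) = η w₀
    · obtain ⟨u, v, rfl, rfl, hu, hub, hw⟩ := hex
      have hne := h.ne_of_left_cut hu hub
      have heq : {w | ∃ u' v', w = u' * FreeMonoid.of b * v' ∧ α u' = α u ∧ η v' = η v ∧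
          RStays α q u' ∧ ¬ RStays α q (u' * FreeMonoid.of b) ∧ η w = η w₀ ∧
          α (q * w * r) = m} = MarkedCat {u' | η u' = η u ∧ α u' = α u} b
          {v' | η v' = η v ∧ α (q * (u * FreeMonoid.of b) * v' * r) = m} := by
        ext w
        constructor
        · rintro ⟨u', v', rfl, h1, h2, -, -, -, h3⟩
          refine ⟨u', ⟨h.refines h1, h1⟩, v', ⟨h2, ?_⟩, rfl⟩
          rw [← h3]
          simp [h1, mul_assoc]
        · rintro ⟨u', ⟨h0, h1⟩, v', ⟨h2, h3⟩, rfl⟩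
          refine ⟨u', v', rfl, h1, h2, hu.congr h1.symm,
            fun h' => hub (h'.congr (by simp [h1])), ?_, ?_⟩
          · rw [← hw]; simp [h0, h2]
          · rw [← h3]; simp [h1, mul_assoc]
      rw [heq]
      refine .leftCat b (ihJ u (jDepth_lt_of_left_cut hw hne) _) ?_
        (leftCDeterministic_of_fiber hC hη (fun _ h => h.1) hne)
      by_cases hlt : jDepth η v < jDepth η w₀
      · refine .of_fibers hC _ α fun s => ?_
        by_cases hs : α (q * (u * FreeMonoid.of b)) * s * α r = m
        · convert ihJ v hlt s using 1
          ext v'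
          simp only [Set.mem_ofPred_eq]
          refine ⟨fun h' => ⟨h'.1.1, h'.2⟩, fun h' => ⟨⟨h'.1, ?_⟩, h'.2⟩⟩
          rw [map_mul, map_mul, h'.2, hs]
        · convert WAPol.base hC.1 using 1
          ext v'
          simp only [Set.mem_ofPred_eq, Set.mem_empty_iff_false, iff_false]
          rintro ⟨⟨-, h1⟩, rfl⟩
          exact hs (by rw [← h1]; simp only [map_mul])
      · have hJ : JBelow η w₀ v := ⟨u * FreeMonoid.of b, 1, by simpa using hw⟩
        exact ihR _ v hub hw (hJ.symm_of_not_lt hlt) m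
    · convert WAPol.base hC.1 using 1
      ext w
      simp only [Set.mem_ofPred_eq, Set.mem_empty_iff_false, iff_false]
      rintro ⟨u, v, rfl, h1, h2, h3, h4, h5, -⟩
      exact hex ⟨u, v, h1, h2, h3, h4, h5⟩

theorem WAPol.fiber_of_right_cut [Finite A] {C : LangClass A} (hC : IsLatticeClass C)
    {α : FreeMonoid A →* M} {η : FreeMonoid A →* N} (h : IsLocallyTrivialExt α η)
    (hη : ∀ p, η ⁻¹' {p} ∈ C) {q r w₀ : FreeMonoid A}
    (ihJ : ∀ w, jDepth η w < jDepth η w₀ → ∀ m, WAPol C {v | η v = η w ∧ α v = m})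
    (ihL : ∀ u z, ¬ LStays α r z → η (u * z) = η w₀ → JBelow η u w₀ →
      ∀ m, WAPol C {u' | η u' = η u ∧ α (q * u' * (z * r)) = m})
    (hr : ¬ LStays α r w₀) (m : M) :
    WAPol C {w | η w = η w₀ ∧ α (q * w * r) = m} := by
  refine .of_finite_cover hC _ (fun i : A × M × N => {w | ∃ u v, w = u * FreeMonoid.of i.1 * v ∧
    α v = i.2.1 ∧ η u = i.2.2 ∧ LStays α r v ∧ ¬ LStays α r (FreeMonoid.of i.1 * v) ∧
    η w = η w₀ ∧ α (q * w * r) = m}) ?_ ?_ ?_ ?_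
  · rintro w ⟨hw, hm⟩
    obtain ⟨u, b, v, rfl, h1, h2⟩ := exists_right_cut w (LStays α r) (.one α r)
      (fun hw' => hr (h.lStays hw' hw.symm))
    exact ⟨(b, α v, η u), u, v, rfl, rfl, rfl, h1, h2, hw, hm⟩
  · rintro i w ⟨u, v, -, -, -, -, -, h1, h2⟩
    exact ⟨h1, h2⟩
  · rintro ⟨b, s, p⟩ ⟨b', s', p'⟩ w ⟨u, v, hw, rfl, rfl, h1, h2, -, -⟩
      ⟨u', v', hw', rfl, rfl, h1', h2', -, -⟩
    rcases marked_eq_trichotomy (hw.symm.trans hw') with ⟨rfl, rfl, rfl⟩ | ⟨t, -, ht⟩ |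
      ⟨t, -, ht⟩
    · rfl
    · rw [ht, mul_assoc] at h1
      exact (h2' h1.right).elim
    · rw [ht, mul_assoc] at h1'
      exact (h2 h1'.right).elim
  · rintro ⟨b, s, p⟩
    by_cases hex : ∃ u v, α v = s ∧ η u = p ∧ LStays α r v ∧
        ¬ LStays α r (FreeMonoid.of b * v) ∧ η (u * FreeMonoid.of b * v) = η w₀
    · obtain ⟨u, v, rfl, rfl, hv, hbv, hw⟩ := hex
      have hne := h.ne_of_right_cut hv hbv
      have heq : {w | ∃ u' v', w = u' * FreeMonoid.of b * v' ∧ α v' = α v ∧ η u' = η u ∧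
          LStays α r v' ∧ ¬ LStays α r (FreeMonoid.of b * v') ∧ η w = η w₀ ∧
          α (q * w * r) = m} =
          MarkedCat {u' | η u' = η u ∧ α (q * u' * (FreeMonoid.of b * v * r)) = m} b
          {v' | η v' = η v ∧ α v' = α v} := by
        ext w
        constructor
        · rintro ⟨u', v', rfl, h1, h2, -, -, -, h3⟩
          refine ⟨u', ⟨h2, ?_⟩, v', ⟨h.refines h1, h1⟩, rfl⟩
          rw [← h3]
          simp [h1, mul_assoc]
        · rintro ⟨u', ⟨h2, h3⟩, v', ⟨h0, h1⟩, rfl⟩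
          refine ⟨u', v', rfl, h1, h2, hv.congr h1.symm,
            fun h' => hbv (h'.congr (by simp [h1])), ?_, ?_⟩
          · rw [← hw]; simp [h0, h2]
          · rw [← h3]; simp [h1, mul_assoc]
      rw [heq]
      refine .rightCat b ?_ (ihJ v (jDepth_lt_of_right_cut hw hne) _)
        (rightCDeterministic_of_fiber hC hη (fun _ h => h.1) hne)
      by_cases hlt : jDepth η u < jDepth η w₀
      · refine .of_fibers hC _ α fun s => ?_
        by_cases hs : α q * s * α (FreeMonoid.of b * v * r) = m
        · convert ihJ u hlt s using 1
          ext u'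
          simp only [Set.mem_ofPred_eq]
          refine ⟨fun h' => ⟨h'.1.1, h'.2⟩, fun h' => ⟨⟨h'.1, ?_⟩, h'.2⟩⟩
          rw [map_mul, map_mul _ q, h'.2, hs]
        · convert WAPol.base hC.1 using 1
          ext u'
          simp only [Set.mem_ofPred_eq, Set.mem_empty_iff_false, iff_false]
          rintro ⟨⟨-, h1⟩, rfl⟩
          exact hs (by rw [← h1]; simp only [map_mul])
      · have hJ : JBelow η w₀ u := ⟨1, FreeMonoid.of b * v, by simpa [mul_assoc] using hw⟩
        exact ihL u _ hbv (by rw [← hw, mul_assoc]) (hJ.symm_of_not_lt hlt) m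
    · convert WAPol.base hC.1 using 1
      ext w
      simp only [Set.mem_ofPred_eq, Set.mem_empty_iff_false, iff_false]
      rintro ⟨u, v, rfl, h1, h2, h3, h4, h5, -⟩
      exact hex ⟨u, v, h1, h2, h3, h4, h5⟩

theorem WAPol.fiber_aux [Finite A] {C : LangClass A} (hC : IsLatticeClass C)
    {α : FreeMonoid A →* M} {η : FreeMonoid A →* N} (h : IsLocallyTrivialExt α η)
    (hη : ∀ p, η ⁻¹' {p} ∈ C) (k : ℕ)
    (ihJ : ∀ w, jDepth η w < k → ∀ m, WAPol C {v | η v = η w ∧ α v = m}) :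
    ∀ (n : ℕ) (q r w₀ : FreeMonoid A), rSize α q + lSize α r = n → jDepth η w₀ = k →
      JBelow η w₀ (q * w₀) → JBelow η w₀ (w₀ * r) →
      ∀ m, WAPol C {w | η w = η w₀ ∧ α (q * w * r) = m} := by
  intro n
  induction n using Nat.strong_induction_on with
  | _ n ih =>
  rintro q r w₀ rfl rfl hqw hwr m
  have hdepth : ∀ v, JBelow η w₀ v → JBelow η v w₀ → jDepth η v = jDepth η w₀ :=
    fun v h1 h2 => le_antisymm (jDepth_le h1) (jDepth_le h2)
  have transport : ∀ {x y : FreeMonoid A}, η x = η y → JBelow η x y :=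
    fun hxy => ⟨1, 1, by simp [hxy]⟩
  by_cases hq : RStays α q w₀
  · by_cases hr : LStays α r w₀
    · by_cases hm : α (q * w₀ * r) = m
      · convert WAPol.base (hη (η w₀)) using 1
        ext w
        simp only [Set.mem_ofPred_eq, Set.mem_preimage, Set.mem_singleton_iff]
        exact ⟨fun h' => h'.1, fun h' => ⟨h', by rw [h.const_on_fiber hq hr hqw hwr h', hm]⟩⟩
      · convert WAPol.base hC.1 using 1
        ext w
        simp only [Set.mem_ofPred_eq, Set.mem_empty_iff_false, iff_false]
        rintro ⟨h1, h2⟩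
        exact hm (by rw [← h2, h.const_on_fiber hq hr hqw hwr h1])
    · refine .fiber_of_right_cut hC h hη ihJ ?_ hr m
      intro u z hz huz hu m'
      refine ih _ (Nat.add_lt_add_left (lSize_lt hz) _) q (z * r) u rfl
        (hdepth u ⟨1, z, by simpa using huz⟩ hu) ?_ ?_ m'
      · refine (hu.trans hqw).trans ⟨1, z, ?_⟩
        rw [one_mul, mul_assoc, map_mul, huz, map_mul]
      · refine (hu.trans hwr).trans (transport ?_)
        rw [← mul_assoc, map_mul, map_mul _ (u * z), huz]
  · refine .fiber_of_left_cut hC h hη ihJ ?_ hq m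
    intro z v hz hzv hv m'
    refine ih _ (Nat.add_lt_add_right (rSize_lt hz) _) (q * z) r v rfl
      (hdepth v ⟨z, 1, by simpa using hzv⟩ hv) ?_ ?_ m'
    · refine (hv.trans hqw).trans (transport ?_)
      rw [mul_assoc, map_mul, map_mul _ q (z * v), hzv]
    · refine (hv.trans hwr).trans ⟨z, 1, ?_⟩
      rw [mul_one, ← mul_assoc, map_mul, hzv, map_mul]

theorem WAPol.fiber [Finite A] {C : LangClass A} (hC : IsLatticeClass C)
    {α : FreeMonoid A →* M} {η : FreeMonoid A →* N} (h : IsLocallyTrivialExt α η)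
    (hη : ∀ p, η ⁻¹' {p} ∈ C) (w₀ : FreeMonoid A) (m : M) :
    WAPol C {w | η w = η w₀ ∧ α w = m} := by
  induction hk : jDepth η w₀ using Nat.strong_induction_on generalizing w₀ m with
  | _ k ih =>
  have h1 := WAPol.fiber_aux hC h hη k (fun w hw m => ih _ hw w m rfl) _ 1 1 w₀ rfl hk
    (by simpa using JBelow.refl η w₀) (by simpa using JBelow.refl η w₀) m
  simpa using h1

theorem WAPol.of_saturated [Finite A] {C : LangClass A} (hC : IsLatticeClass C)
    {α : FreeMonoid A →* M} {η : FreeMonoid A →* N} (h : IsLocallyTrivialExt α η)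
    (hη : ∀ p, η ⁻¹' {p} ∈ C) {L : Lang A} (hL : ∀ u v, α u = α v → (u ∈ L ↔ v ∈ L)) :
    WAPol C L := by
  refine .of_fibers hC L α fun m => ?_
  by_cases hm : ∃ w ∈ L, α w = m
  · obtain ⟨w₀, hw₀, rfl⟩ := hm
    convert WAPol.fiber hC h hη w₀ (α w₀) using 1
    ext w
    exact ⟨fun hw => ⟨h.refines hw.2, hw.2⟩, fun hw => ⟨(hL _ _ hw.2).2 hw₀, hw.2⟩⟩
  · convert WAPol.base hC.1 using 1
    ext w
    simp only [Set.mem_ofPred_eq, Set.mem_empty_iff_false, iff_false]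
    exact fun hw => hm ⟨w, hw⟩

end Ext

/-! ### Comparison of the closures -/

theorem UPol.wAPol {A : Type} [Finite A] {C : LangClass A} (hC : IsPrevariety C) {L : Lang A}
    (hL : UPol C L) : WAPol C L := by
  obtain ⟨M, _, _, α, N, _, _, η, h, hη, hs⟩ := (hL.locallyTrivialOver hC).exists_ext
  exact .of_saturated hC.1.1 h hη hs

theorem WAPol.aPol {A : Type} {C : LangClass A} {L : Lang A} (hL : WAPol C L) : APol C L := by
  induction hL with
  | base h => exact .base h
  | disjUnion _ _ hd ihK ihL => exact .disjUnion ihK ihL hd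
  | leftCat a _ _ hdet ihK ihL =>
    refine .leftCat a ihK ihL ?_
    obtain ⟨K', -, L', -, hK, -, hd⟩ := hdet
    refine Set.subset_empty_iff.1 (subset_trans ?_ (Set.subset_empty_iff.2 hd))
    rintro w ⟨h1, u, hu, v, hv, huv⟩
    exact ⟨hK h1, u, hK hu, v, hv, huv⟩
  | rightCat a _ _ hdet ihK ihL =>
    refine .rightCat a ihK ihL ?_
    obtain ⟨K', -, L', -, -, hL, hd⟩ := hdet
    refine Set.subset_empty_iff.1 (subset_trans ?_ (Set.subset_empty_iff.2 hd))
    rintro w ⟨h1, u, hu, v, hv, huv⟩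
    exact ⟨hL h1, u, hu, v, hL hv, huv⟩

theorem LeftDeterministic.unambiguous {A : Type} {K L : Lang A} {a : A}
    (h : LeftDeterministic K a L) : Unambiguous K a L := by
  have hno : ∀ u ∈ K, ∀ t, u * FreeMonoid.of a * t ∉ K := fun u hu t ht =>
    (Set.eq_empty_iff_forall_notMem.1 h _) ⟨ht, u, hu, t, trivial, rfl⟩
  intro u u' v v' hu hu' _ _ heq
  rcases marked_eq_trichotomy heq with ⟨h1, -, h2⟩ | ⟨t, rfl, -⟩ | ⟨t, rfl, -⟩
  · exact ⟨h1, h2⟩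
  · exact (hno _ hu _ hu').elim
  · exact (hno _ hu' _ hu).elim

theorem RightDeterministic.unambiguous {A : Type} {K L : Lang A} {a : A}
    (h : RightDeterministic K a L) : Unambiguous K a L := by
  have hno : ∀ v ∈ L, ∀ t, t * FreeMonoid.of a * v ∉ L := fun v hv t ht =>
    (Set.eq_empty_iff_forall_notMem.1 h _) ⟨ht, t, trivial, v, hv, rfl⟩
  intro u u' v v' _ _ hv hv' heq
  rcases marked_eq_trichotomy heq with ⟨h1, -, h2⟩ | ⟨t, -, rfl⟩ | ⟨t, -, rfl⟩
  · exact ⟨h1, h2⟩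
  · exact (hno _ hv' _ hv).elim
  · exact (hno _ hv _ hv').elim

theorem APol.uPol {A : Type} {C : LangClass A} {L : Lang A} (hL : APol C L) : UPol C L := by
  induction hL with
  | base h => exact .base h
  | disjUnion _ _ hd ihK ihL => exact .disjUnion ihK ihL hd
  | leftCat a _ _ hdet ihK ihL => exact .mcat a ihK ihL hdet.unambiguous
  | rightCat a _ _ hdet ihK ihL => exact .mcat a ihK ihL hdet.unambiguous

/-- For a prevariety `C`, the unambiguous, alternated and weak alternated
polynomial closures coincide: `UPol C = APol C = WAPol C`. -/
theorem upol_eq_apol_eq_wapol {A : Type} [Fintype A] (C : LangClass A)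
    (hC : IsPrevariety C) :
    {L : Lang A | UPol C L} = {L : Lang A | APol C L} ∧
      {L : Lang A | APol C L} = {L : Lang A | WAPol C L} := by
  refine ⟨Set.ext fun L => ?_, Set.ext fun L => ?_⟩
  · exact ⟨fun h => (UPol.wAPol hC h).aPol, APol.uPol⟩
  · exact ⟨fun h => UPol.wAPol hC (APol.uPol h), WAPol.aPol⟩

end RegLang
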